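/- Let n ≥ 4, a > 0, r > 0, and set γ := a²(n−1)/(a²+n−3). Consider the 2n−2 points of ℝ^n: c_1=(1,1,1,0,…,0), c_2=(1,−1,−1,0,…,0), c_3=(−1,1,−1,0,…,0), c_4=(−1,−1,1,0,…,0), and ±a·e_j for j = 4,…,n. If (r²−3)·(3−γ)·(a²−2)·(r²−γ)·((3−γ)² + 4γ − 4r²) ≠ 0, then the set of one-dimensional affine subspaces L of ℂ^n tangent to all 2n−2 spheres with these centers and common radius r (i.e. satisfying (v·(p−c))² = (v·v)·((p−c)² − r²) for some p ∈ L and nonzero direction v of L, for each center c) is finite with exactly 3·2^{n−1} elements. -/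

import Mathlib

open scoped BigOperators

/-- The bilinear (conjugation-free) dot product on `ℂⁿ`. -/
noncomputable def dotc {n : ℕ} (x y : Fin n → ℂ) : ℂ := ∑ i, x i * y i

/-- A one-dimensional affine subspace `L ⊆ ℂⁿ` is tangent to the sphere with center `c`
and radius `r` when for some point `p ∈ L` and nonzero direction vector `v` of `L` one has
`(v·(p−c))² = (v·v)·((p−c)² − r²)`. -/
def IsTangentLine {n : ℕ} (L : AffineSubspace ℂ (Fin n → ℂ)) (c : Fin n → ℂ) (r : ℝ) : Prop :=
  ∃ p ∈ L, ∃ v ∈ L.direction, v ≠ 0 ∧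
    dotc v (p - c) ^ 2 = dotc v v * (dotc (p - c) (p - c) - (r : ℂ) ^ 2)

/-- The tetrahedron vertex `(1,1,1,0,…,0)` of `ℝⁿ`. -/
def tetraA (n : ℕ) : Fin n → ℝ := fun i =>
  if i.val = 0 then 1 else if i.val = 1 then 1 else if i.val = 2 then 1 else 0

/-- The tetrahedron vertex `(1,−1,−1,0,…,0)` of `ℝⁿ`. -/
def tetraB (n : ℕ) : Fin n → ℝ := fun i =>
  if i.val = 0 then 1 else if i.val = 1 then -1 else if i.val = 2 then -1 else 0

/-- The tetrahedron vertex `(−1,1,−1,0,…,0)` of `ℝⁿ`. -/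
def tetraC (n : ℕ) : Fin n → ℝ := fun i =>
  if i.val = 0 then -1 else if i.val = 1 then 1 else if i.val = 2 then -1 else 0

/-- The tetrahedron vertex `(−1,−1,1,0,…,0)` of `ℝⁿ`. -/
def tetraD (n : ℕ) : Fin n → ℝ := fun i =>
  if i.val = 0 then -1 else if i.val = 1 then -1 else if i.val = 2 then 1 else 0

/-- The `2n−2` centers: the four tetrahedron vertices together with `±a·eⱼ` for
`j = 4,…,n` (in 1-based indexing; `3 ≤ j.val` in the 0-based indexing of `Fin n`). -/
def configCenters (n : ℕ) (a : ℝ) : Set (Fin n → ℝ) :=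
  {tetraA n, tetraB n, tetraC n, tetraD n} ∪
    {x | ∃ j : Fin n, 3 ≤ j.val ∧ (x = a • (Pi.single j 1 : Fin n → ℝ) ∨ x = -(a • (Pi.single j 1 : Fin n → ℝ)))}


section DotProduct

variable {n : ℕ}

theorem dotc_eq_dotProduct (x y : Fin n → ℂ) : dotc x y = x ⬝ᵥ y := rfl

theorem dotc_comm (x y : Fin n → ℂ) : dotc x y = dotc y x := dotProduct_comm x y

theorem dotc_sub_right (x y z : Fin n → ℂ) : dotc x (y - z) = dotc x y - dotc x z :=
  dotProduct_sub x y z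

theorem dotc_sub_left (x y z : Fin n → ℂ) : dotc (x - y) z = dotc x z - dotc y z :=
  sub_dotProduct x y z

theorem dotc_add_right (x y z : Fin n → ℂ) : dotc x (y + z) = dotc x y + dotc x z :=
  dotProduct_add x y z

theorem dotc_add_left (x y z : Fin n → ℂ) : dotc (x + y) z = dotc x z + dotc y z :=
  add_dotProduct x y z

theorem dotc_smul_right (k : ℂ) (x y : Fin n → ℂ) : dotc x (k • y) = k * dotc x y :=
  dotProduct_smul k x y

theorem dotc_smul_left (k : ℂ) (x y : Fin n → ℂ) : dotc (k • x) y = k * dotc x y :=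
  smul_dotProduct k x y

theorem dotc_neg_right (x y : Fin n → ℂ) : dotc x (-y) = -dotc x y :=
  dotProduct_neg x y

/-- Tangency of a line may be tested at any of its points and for any direction vector. -/
theorem isTangentLine_iff {L : AffineSubspace ℂ (Fin n → ℂ)}
    (hL : Module.finrank ℂ L.direction = 1) {p v : Fin n → ℂ} (hp : p ∈ L)
    (hv : v ∈ L.direction) (hv0 : v ≠ 0) (c : Fin n → ℂ) (r : ℝ) :
    IsTangentLine L c r ↔
      dotc v (p - c) ^ 2 = dotc v v * (dotc (p - c) (p - c) - (r : ℂ) ^ 2) := by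
  refine ⟨?_, fun h => ⟨p, hp, v, hv, hv0, h⟩⟩
  rintro ⟨q, hq, w, hw, hw0, h⟩
  have hspan := (finrank_eq_one_iff_of_nonzero' (⟨v, hv⟩ : L.direction)
    (by simpa [Subtype.ext_iff] using hv0)).1 hL
  obtain ⟨k, hk⟩ := hspan ⟨w, hw⟩
  obtain ⟨s, hs⟩ := hspan ⟨q - p, AffineSubspace.vsub_mem_direction hq hp⟩
  replace hk : k • v = w := congrArg Subtype.val hk
  replace hs : s • v = q - p := congrArg Subtype.val hs
  have hk0 : k ≠ 0 := by
    rintro rfl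
    exact hw0 (by rw [← hk, zero_smul])
  have hqc : q - c = (p - c) + s • v := by rw [hs]; abel
  rw [hqc, ← hk] at h
  simp only [dotc_add_right, dotc_add_left, dotc_smul_left, dotc_smul_right] at h
  rw [dotc_comm (p - c) v] at h
  refine mul_left_cancel₀ (pow_ne_zero 2 hk0) ?_
  linear_combination h

theorem eq_mk'_span_of_finrank_direction {L : AffineSubspace ℂ (Fin n → ℂ)}
    (hL : Module.finrank ℂ L.direction = 1) {p v : Fin n → ℂ} (hp : p ∈ L)
    (hv : v ∈ L.direction) (hv0 : v ≠ 0) : AffineSubspace.mk' p (ℂ ∙ v) = L := by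
  have h : (ℂ ∙ v) = L.direction := by
    refine Submodule.eq_of_le_of_finrank_eq ?_ ?_
    · simpa using hv
    · rw [finrank_span_singleton hv0, hL]
  rw [h, AffineSubspace.mk'_eq hp]

end DotProduct

section Coordinates

variable {m : ℕ}

theorem dotc_eq_add_sum (x y : Fin (m + 4) → ℂ) :
    dotc x y = x 0 * y 0 + x 1 * y 1 + x 2 * y 2 +
      ∑ i : Fin (m + 1), x i.succ.succ.succ * y i.succ.succ.succ := by
  simp only [dotc, Fin.sum_univ_succ (n := m + 3), Fin.sum_univ_succ (n := m + 2),
    Fin.sum_univ_succ (n := m + 1)]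
  simp only [add_assoc]
  rfl

theorem val_two_fin_add_four : ((2 : Fin (m + 4)) : ℕ) = 2 := Fin.val_two (n := m + 1)

theorem dotc_tetraA (x : Fin (m + 4) → ℂ) :
    dotc x (fun j => (tetraA (m + 4) j : ℂ)) = x 0 + x 1 + x 2 := by
  simp [dotc_eq_add_sum, tetraA]

theorem dotc_tetraB (x : Fin (m + 4) → ℂ) :
    dotc x (fun j => (tetraB (m + 4) j : ℂ)) = x 0 - x 1 - x 2 := by
  simp only [dotc_eq_add_sum, tetraB, val_two_fin_add_four]
  simp
  ring

theorem dotc_tetraC (x : Fin (m + 4) → ℂ) :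
    dotc x (fun j => (tetraC (m + 4) j : ℂ)) = -x 0 + x 1 - x 2 := by
  simp only [dotc_eq_add_sum, tetraC, val_two_fin_add_four]
  simp
  ring

theorem dotc_tetraD (x : Fin (m + 4) → ℂ) :
    dotc x (fun j => (tetraD (m + 4) j : ℂ)) = -x 0 - x 1 + x 2 := by
  simp only [dotc_eq_add_sum, tetraD, val_two_fin_add_four]
  simp
  ring

theorem forall_configCenters_iff (a : ℝ) (Q : (Fin (m + 4) → ℂ) → Prop) :
    (∀ c ∈ configCenters (m + 4) a, Q (fun j => (c j : ℂ))) ↔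
      Q (fun j => (tetraA (m + 4) j : ℂ)) ∧ Q (fun j => (tetraB (m + 4) j : ℂ)) ∧
      Q (fun j => (tetraC (m + 4) j : ℂ)) ∧ Q (fun j => (tetraD (m + 4) j : ℂ)) ∧
      ∀ i : Fin (m + 1), Q ((a : ℂ) • Pi.single i.succ.succ.succ 1) ∧
        Q (-((a : ℂ) • Pi.single i.succ.succ.succ 1)) := by
  have hpos (j : Fin (m + 4)) : (fun i => (((a • (Pi.single j 1 : Fin (m + 4) → ℝ)) i : ℝ) : ℂ)) =
      (a : ℂ) • Pi.single j 1 := by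
    ext i
    by_cases h : i = j
    · subst h; simp
    · simp [h]
  have hneg (j : Fin (m + 4)) :
      (fun i => (((-(a • (Pi.single j 1 : Fin (m + 4) → ℝ))) i : ℝ) : ℂ)) =
      -((a : ℂ) • Pi.single j 1) := by
    rw [← hpos]; ext i; simp
  constructor
  · intro h
    refine ⟨h _ (by simp [configCenters]), h _ (by simp [configCenters]),
      h _ (by simp [configCenters]), h _ (by simp [configCenters]), fun i => ⟨?_, ?_⟩⟩
    · rw [← hpos]
      exact h _ (Or.inr ⟨i.succ.succ.succ, by simp, Or.inl rfl⟩)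
    · rw [← hneg]
      exact h _ (Or.inr ⟨i.succ.succ.succ, by simp, Or.inr rfl⟩)
  · rintro ⟨hA, hB, hC, hD, hE⟩ c ((rfl | rfl | rfl | rfl) | ⟨j, hj, hc⟩)
    · exact hA
    · exact hB
    · exact hC
    · exact hD
    · obtain ⟨i, rfl⟩ : ∃ i : Fin (m + 1), i.succ.succ.succ = j :=
        ⟨⟨j.val - 3, by omega⟩, by ext; simp; omega⟩
      rcases hc with rfl | rfl
      · rw [hpos]; exact (hE i).1
      · rw [hneg]; exact (hE i).2

theorem eq_of_coordinates_eq {x y : Fin (m + 4) → ℂ} (h0 : x 0 = y 0) (h1 : x 1 = y 1)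
    (h2 : x 2 = y 2) (h : ∀ i : Fin (m + 1), x i.succ.succ.succ = y i.succ.succ.succ) :
    x = y := by
  ext i
  refine Fin.cases h0 (fun i => Fin.cases h1 (fun i => Fin.cases h2 h i) i) i

theorem dotc_single (x : Fin (m + 4) → ℂ) (j : Fin (m + 4)) :
    dotc x (Pi.single j 1) = x j := by
  rw [dotc_eq_dotProduct, dotProduct_single_one]

/-- The direction of a common tangent line is not isotropic. -/
theorem dotc_self_ne_zero_of_tangent {a r : ℝ} (ha : a ≠ 0) {v p : Fin (m + 4) → ℂ} (hv0 : v ≠ 0)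
    (h : ∀ c ∈ configCenters (m + 4) a, dotc v (p - fun j => (c j : ℂ)) ^ 2 =
      dotc v v * (dotc (p - fun j => (c j : ℂ)) (p - fun j => (c j : ℂ)) - (r : ℂ) ^ 2)) :
    dotc v v ≠ 0 := by
  intro hv
  rw [forall_configCenters_iff a (fun c => dotc v (p - c) ^ 2 =
    dotc v v * (dotc (p - c) (p - c) - (r : ℂ) ^ 2))] at h
  simp only [hv, zero_mul, pow_eq_zero_iff two_ne_zero, dotc_sub_right, dotc_tetraA, dotc_tetraB,
    dotc_tetraC, dotc_tetraD, dotc_neg_right, dotc_smul_right, dotc_single] at h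
  obtain ⟨hA, hB, hC, hD, hE⟩ := h
  have hp : dotc v p = 0 := by linear_combination (hE 0).1 / 2 + (hE 0).2 / 2
  have ha' : (a : ℂ) ≠ 0 := by exact_mod_cast ha
  apply hv0
  refine eq_of_coordinates_eq ?_ ?_ ?_ fun i => ?_
  · simp only [Pi.zero_apply]; linear_combination hp - hA / 2 - hB / 2
  · simp only [Pi.zero_apply]; linear_combination hp - hA / 2 - hC / 2
  · simp only [Pi.zero_apply]; linear_combination hp - hA / 2 - hD / 2
  · refine (mul_eq_zero.1 ?_).resolve_left ha'
    linear_combination hp - (hE i).1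

/-- The point of the common tangent line with unit direction `v` closest to the origin. -/
def footPoint (v : Fin (m + 4) → ℂ) : Fin (m + 4) → ℂ :=
  Matrix.vecCons (-(v 1 * v 2)) (Matrix.vecCons (-(v 0 * v 2)) (Matrix.vecCons (-(v 0 * v 1)) 0))

/-- The equations cutting out the unit directions of common tangent lines: the squares of the
first three coordinates have elementary symmetric functions `3 - γ`, `r² - γ` and `0`, and those
of the other coordinates all equal `t`. -/
def IsTangentDirection (γ ρ t : ℂ) (v : Fin (m + 4) → ℂ) : Prop :=
  v 0 ^ 2 + v 1 ^ 2 + v 2 ^ 2 = 3 - γ ∧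
  v 0 ^ 2 * v 1 ^ 2 + v 1 ^ 2 * v 2 ^ 2 + v 0 ^ 2 * v 2 ^ 2 = ρ ^ 2 - γ ∧
  v 0 * v 1 * v 2 = 0 ∧ ∀ i : Fin (m + 1), v i.succ.succ.succ ^ 2 = t

theorem IsTangentDirection.neg {γ ρ t : ℂ} {v : Fin (m + 4) → ℂ}
    (h : IsTangentDirection γ ρ t v) : IsTangentDirection γ ρ t (-v) := by
  obtain ⟨h1, h2, h3, h4⟩ := h
  refine ⟨by simpa using h1, by simpa using h2, ?_, by simpa using h4⟩
  simp only [Pi.neg_apply]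
  linear_combination -h3

theorem footPoint_neg (v : Fin (m + 4) → ℂ) : footPoint (-v) = footPoint v := by
  simp [footPoint]

theorem IsTangentDirection.dotc_self {γ ρ t : ℂ} {v : Fin (m + 4) → ℂ}
    (h : IsTangentDirection γ ρ t v) (hNt : ((m : ℂ) + 1) * t = γ - 2) : dotc v v = 1 := by
  obtain ⟨h1, -, -, h4⟩ := h
  rw [dotc_eq_add_sum]
  simp only [← pow_two, h4, Finset.sum_const, Finset.card_univ, Fintype.card_fin, nsmul_eq_mul]
  push_cast
  linear_combination h1 + hNt

theorem dotc_footPoint (x v : Fin (m + 4) → ℂ) :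
    dotc x (footPoint v) = -(x 0 * (v 1 * v 2) + x 1 * (v 0 * v 2) + x 2 * (v 0 * v 1)) := by
  have h1 : footPoint v 1 = -(v 0 * v 2) := rfl
  have h2 : footPoint v 2 = -(v 0 * v 1) := rfl
  have h0 : footPoint v 0 = -(v 1 * v 2) := rfl
  have h3 (i : Fin (m + 1)) : footPoint v i.succ.succ.succ = 0 := rfl
  rw [dotc_eq_add_sum, h0, h1, h2]
  simp only [h3]
  simp
  ring

/-- Description of the common tangents by a unit direction and an orthogonal base point. -/
theorem tangent_iff_isTangentDirection {a r : ℝ} {γ t : ℂ} (ha : a ≠ 0)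
    (hat : (a : ℂ) ^ 2 * t = a ^ 2 - γ) (hNt : ((m : ℂ) + 1) * t = γ - 2)
    {v p : Fin (m + 4) → ℂ} (hv : dotc v v = 1) (hvp : dotc v p = 0) :
    (∀ c ∈ configCenters (m + 4) a, dotc v (p - fun j => (c j : ℂ)) ^ 2 =
      dotc v v * (dotc (p - fun j => (c j : ℂ)) (p - fun j => (c j : ℂ)) - (r : ℂ) ^ 2)) ↔
      IsTangentDirection γ r t v ∧ p = footPoint v := by
  have ha' : (a : ℂ) ≠ 0 := by exact_mod_cast ha
  have hN : (a : ℂ) ^ 2 + (m + 1) ≠ 0 := by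
    have : a ^ 2 + (m + 1) ≠ 0 := by positivity
    exact_mod_cast this
  rw [forall_configCenters_iff a (fun c => dotc v (p - c) ^ 2 =
    dotc v v * (dotc (p - c) (p - c) - (r : ℂ) ^ 2))]
  have expand (c : Fin (m + 4) → ℂ) : dotc v (p - c) ^ 2 =
      dotc v v * (dotc (p - c) (p - c) - (r : ℂ) ^ 2) ↔
      dotc v c ^ 2 = dotc p p - 2 * dotc p c + dotc c c - (r : ℂ) ^ 2 := by
    rw [hv, dotc_sub_right, hvp, dotc_sub_right, dotc_sub_left, dotc_sub_left, dotc_comm c p]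
    constructor <;> intro h <;> linear_combination h
  simp only [expand]
  simp only [dotc_tetraA, dotc_tetraB, dotc_tetraC, dotc_tetraD, dotc_neg_right,
    dotc_smul_right, dotc_single]
  simp only [tetraA, tetraB, tetraC, tetraD, Pi.single_eq_same, Pi.smul_apply, Pi.neg_apply, smul_eq_mul]
  simp only [Fin.val_zero, Fin.val_one, val_two_fin_add_four, if_true, if_false, one_ne_zero,
    OfNat.ofNat_ne_zero, OfNat.ofNat_ne_one, Complex.ofReal_one, Complex.ofReal_neg]
  constructor
  · rintro ⟨hA, hB, hC, hD, hE⟩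
    have p0 : p 0 = -(v 1 * v 2) := by linear_combination (hA + hB - hC - hD) / 8
    have p1 : p 1 = -(v 0 * v 2) := by linear_combination (hA - hB + hC - hD) / 8
    have p2 : p 2 = -(v 0 * v 1) := by linear_combination (hA - hB - hC + hD) / 8
    have p3 (i : Fin (m + 1)) : p i.succ.succ.succ = 0 := by
      refine (mul_eq_zero.1 ?_).resolve_left ha'
      linear_combination ((hE i).1 - (hE i).2) / 4
    have hp : p = footPoint v := eq_of_coordinates_eq p0 p1 p2 p3
    have hvp' := hvp
    rw [hp, dotc_footPoint] at hvp'
    have h3 : v 0 * v 1 * v 2 = 0 := by linear_combination -hvp' / 3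
    have hpp : dotc p p = v 0 ^ 2 * v 1 ^ 2 + v 1 ^ 2 * v 2 ^ 2 + v 0 ^ 2 * v 2 ^ 2 := by
      conv_lhs => rw [hp]
      rw [dotc_footPoint, ← hp, p0, p1, p2]; ring
    have hE' (i : Fin (m + 1)) :
        (a : ℂ) ^ 2 * v i.succ.succ.succ ^ 2 = dotc p p + a ^ 2 - r ^ 2 := by
      linear_combination ((hE i).1 + (hE i).2) / 2
    have he1 : v 0 ^ 2 + v 1 ^ 2 + v 2 ^ 2 = dotc p p + 3 - r ^ 2 := by
      linear_combination (hA + hB + hC + hD) / 4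
    have hsum : (a : ℂ) ^ 2 * (v 0 ^ 2 + v 1 ^ 2 + v 2 ^ 2) +
        (m + 1) * (dotc p p + a ^ 2 - r ^ 2) = a ^ 2 := by
      have h := congrArg (fun z => (a : ℂ) ^ 2 * z) hv
      rw [dotc_eq_add_sum] at h
      simp only [mul_add, Finset.mul_sum, ← pow_two, hE', Finset.sum_const, Finset.card_univ,
        Fintype.card_fin, nsmul_eq_mul] at h
      push_cast at h
      linear_combination h
    have hq : dotc p p = r ^ 2 - γ := by
      refine mul_left_cancel₀ hN ?_
      linear_combination hsum - (a : ℂ) ^ 2 * he1 - a ^ 2 * hNt + (m + 1) * hat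
    refine ⟨⟨by rw [he1, hq]; ring, by rw [← hpp, hq], h3, fun i => ?_⟩, hp⟩
    refine mul_left_cancel₀ (pow_ne_zero 2 ha') ?_
    rw [hE', hq, hat]; ring
  · rintro ⟨⟨h1, h2, h3, h4⟩, rfl⟩
    have p0 : footPoint v 0 = -(v 1 * v 2) := rfl
    have p1 : footPoint v 1 = -(v 0 * v 2) := rfl
    have p2 : footPoint v 2 = -(v 0 * v 1) := rfl
    have p3 (i : Fin (m + 1)) : footPoint v i.succ.succ.succ = 0 := rfl
    have hpp : dotc (footPoint v) (footPoint v) = r ^ 2 - γ := by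
      rw [dotc_footPoint, p0, p1, p2]; linear_combination h2
    simp only [hpp, p0, p1, p2, p3]
    refine ⟨?_, ?_, ?_, ?_, fun i => ⟨?_, ?_⟩⟩
    · linear_combination h1
    · linear_combination h1
    · linear_combination h1
    · linear_combination h1
    · linear_combination (a : ℂ) ^ 2 * h4 i + hat
    · linear_combination (a : ℂ) ^ 2 * h4 i + hat

end Coordinates

section Lines

variable {m : ℕ}

/-- The line with direction `v` through `footPoint v`. -/
def tangentLineOf (v : Fin (m + 4) → ℂ) : AffineSubspace ℂ (Fin (m + 4) → ℂ) :=
  AffineSubspace.mk' (footPoint v) (ℂ ∙ v)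

theorem tangentLineOf_neg (v : Fin (m + 4) → ℂ) : tangentLineOf (-v) = tangentLineOf v := by
  rw [tangentLineOf, tangentLineOf, footPoint_neg, ← Set.neg_singleton, Submodule.span_neg]

theorem tangentLineOf_injOn {τ : ℂ} (hτ : τ ≠ 0) :
    Set.InjOn (tangentLineOf (m := m)) {v | v 3 = τ} := by
  intro v (hv : v 3 = τ) w (hw : w 3 = τ) h
  have hdir := congrArg AffineSubspace.direction h
  simp only [tangentLineOf, AffineSubspace.direction_mk'] at hdir
  obtain ⟨k, hk⟩ := Submodule.mem_span_singleton.1 (hdir ▸ Submodule.mem_span_singleton_self v)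
  have h3 : k * w 3 = v 3 := congrFun hk 3
  rw [hv, hw] at h3
  rw [← hk, mul_right_cancel₀ hτ (h3.trans (one_mul τ).symm), one_smul]

/-- The common tangent lines correspond to the tangent directions with a fixed value
in the fourth coordinate. -/
theorem tangentLines_eq_image {a r : ℝ} {γ t τ : ℂ} (ha : a ≠ 0)
    (hat : (a : ℂ) ^ 2 * t = a ^ 2 - γ) (hNt : ((m : ℂ) + 1) * t = γ - 2) (hτ : τ ^ 2 = t) :
    {L : AffineSubspace ℂ (Fin (m + 4) → ℂ) | Module.finrank ℂ L.direction = 1 ∧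
        ∀ c ∈ configCenters (m + 4) a, IsTangentLine L (fun j => (c j : ℂ)) r} =
      tangentLineOf '' {v | v 3 = τ ∧ IsTangentDirection γ r t v} := by
  ext L
  constructor
  · rintro ⟨hL, h⟩
    obtain ⟨p, hp⟩ : (L : Set (Fin (m + 4) → ℂ)).Nonempty := by
      obtain ⟨p, hp, -⟩ := h _ (Or.inl (Or.inl rfl))
      exact ⟨p, hp⟩
    obtain ⟨⟨v, hv⟩, hv0, -⟩ := finrank_eq_one_iff'.1 hL
    replace hv0 : v ≠ 0 := fun h0 => hv0 (Subtype.ext h0)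
    have hD := dotc_self_ne_zero_of_tangent ha hv0
      fun c hc => (isTangentLine_iff hL hp hv hv0 _ r).1 (h c hc)
    obtain ⟨s, hs⟩ := IsSquare.exists_sq _ (IsAlgClosed.exists_eq_mul_self (dotc v v))
    have hs0 : s ≠ 0 := by
      rintro rfl
      exact hD (by simpa using hs)
    set u := s⁻¹ • v with hu
    have huL : u ∈ L.direction := L.direction.smul_mem _ hv
    have hu1 : dotc u u = 1 := by
      rw [hu, dotc_smul_left, dotc_smul_right, hs]
      field_simp
    have hu0 : u ≠ 0 := smul_ne_zero (inv_ne_zero hs0) hv0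
    set q := -dotc u p • u + p with hq
    have hqL : q ∈ L :=
      AffineSubspace.vadd_mem_of_mem_direction (L.direction.smul_mem _ huL) hp
    have huq : dotc u q = 0 := by
      rw [hq, dotc_add_right, dotc_smul_right, hu1]
      ring
    obtain ⟨hdir, hfoot⟩ := (tangent_iff_isTangentDirection ha hat hNt hu1 huq).1
      fun c hc => (isTangentLine_iff hL hqL huL hu0 _ r).1 (h c hc)
    have hline : tangentLineOf u = L := by
      rw [tangentLineOf, ← hfoot]
      exact eq_mk'_span_of_finrank_direction hL hqL huL hu0
    have hu3 : u 3 ^ 2 = τ ^ 2 := by rw [hτ]; exact hdir.2.2.2 0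
    rcases sq_eq_sq_iff_eq_or_eq_neg.1 hu3 with h3 | h3
    · exact ⟨u, ⟨h3, hdir⟩, hline⟩
    · exact ⟨-u, ⟨by simp [h3], hdir.neg⟩, by rw [tangentLineOf_neg, hline]⟩
  · rintro ⟨v, ⟨-, hv⟩, rfl⟩
    have hv1 := hv.dotc_self hNt
    have hv0 : v ≠ 0 := by
      rintro rfl
      simp [dotc] at hv1
    have hL : Module.finrank ℂ (tangentLineOf v).direction = 1 := by
      rw [tangentLineOf, AffineSubspace.direction_mk', finrank_span_singleton hv0]
    refine ⟨hL, fun c hc => ?_⟩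
    rw [isTangentLine_iff hL (AffineSubspace.self_mem_mk' _ _)
      (by rw [tangentLineOf, AffineSubspace.direction_mk']
          exact Submodule.mem_span_singleton_self v) hv0]
    refine (tangent_iff_isTangentDirection ha hat hNt hv1 ?_).2 ⟨hv, rfl⟩ c hc
    rw [dotc_footPoint]
    linear_combination -3 * hv.2.2.1

end Lines

section Counting

variable {m : ℕ}

/-- The number `z` or `-z`, according to a sign bit. -/
def signed (b : Bool) (z : ℂ) : ℂ := if b then z else -z

theorem signed_sq (b : Bool) (z : ℂ) : signed b z ^ 2 = z ^ 2 := by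
  cases b <;> simp [signed]

theorem signed_ne_zero (b : Bool) {z : ℂ} (hz : z ≠ 0) : signed b z ≠ 0 := by
  cases b <;> simpa [signed]

theorem signed_left_injective {z : ℂ} (hz : z ≠ 0) : Function.Injective (signed · z) := by
  intro b b' h
  cases b <;> cases b' <;> simp_all [signed, CharZero.neg_eq_self_iff, CharZero.eq_neg_self_iff]

theorem exists_eq_signed {y z : ℂ} (h : y ^ 2 = z ^ 2) : ∃ b, y = signed b z := by
  rcases sq_eq_sq_iff_eq_or_eq_neg.1 h with rfl | rfl
  · exact ⟨true, rfl⟩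
  · exact ⟨false, rfl⟩

/-- The vector of `ℂ³` with a zero at `k` and `±α`, `±β` at the two other places. -/
def signedTriple (α β : ℂ) : Fin 3 × Bool × Bool × Bool → Fin 3 → ℂ
  | (k, s, b, c), i =>
    if i = k then 0
    else if i = k + 1 then signed b (if s then α else β)
    else signed c (if s then β else α)

theorem signedTriple_self (α β : ℂ) (k : Fin 3) (s b c : Bool) :
    signedTriple α β (k, s, b, c) k = 0 := by
  simp [signedTriple]

theorem signedTriple_add_one (α β : ℂ) (k : Fin 3) (s b c : Bool) :
    signedTriple α β (k, s, b, c) (k + 1) = signed b (if s then α else β) := by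
  simp [signedTriple]

theorem signedTriple_add_two (α β : ℂ) (k : Fin 3) (s b c : Bool) :
    signedTriple α β (k, s, b, c) (k + 2) = signed c (if s then β else α) := by
  fin_cases k <;> simp [signedTriple]

theorem signedTriple_eq_zero_iff {α β : ℂ} (hα : α ≠ 0) (hβ : β ≠ 0) (k : Fin 3)
    (s b c : Bool) (i : Fin 3) : signedTriple α β (k, s, b, c) i = 0 ↔ i = k := by
  constructor
  · intro h
    by_contra hik
    simp only [signedTriple, if_neg hik] at h
    split_ifs at h
    all_goals exact signed_ne_zero _ ‹_› h
  · rintro rfl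
    exact signedTriple_self α β i s b c

theorem signedTriple_injective {α β : ℂ} (hα : α ≠ 0) (hβ : β ≠ 0) (hαβ : α ^ 2 ≠ β ^ 2) :
    Function.Injective (signedTriple α β) := by
  rintro ⟨k, s, b, c⟩ ⟨k', s', b', c'⟩ h
  obtain rfl : k = k' := by
    rw [← signedTriple_eq_zero_iff hα hβ k' s' b' c', ← h, signedTriple_self]
  have h1 := congrFun h (k + 1)
  have h2 := congrFun h (k + 2)
  rw [signedTriple_add_one, signedTriple_add_one] at h1
  rw [signedTriple_add_two, signedTriple_add_two] at h2
  obtain rfl : s = s' := by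
    have hsq := congrArg (· ^ 2) h1
    simp only [signed_sq] at hsq
    cases s <;> cases s' <;> simp_all [eq_comm]
  obtain rfl := signed_left_injective (by split_ifs <;> assumption) h1
  obtain rfl := signed_left_injective (by split_ifs <;> assumption) h2
  rfl

theorem exists_signed_pair {α β u w : ℂ} (hsum : u ^ 2 + w ^ 2 = α ^ 2 + β ^ 2)
    (hprod : u ^ 2 * w ^ 2 = α ^ 2 * β ^ 2) :
    ∃ s b c : Bool, u = signed b (if s then α else β) ∧ w = signed c (if s then β else α) := by
  have h : (u ^ 2 - α ^ 2) * (u ^ 2 - β ^ 2) = 0 := by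
    linear_combination u ^ 2 * hsum - hprod
  rcases mul_eq_zero.1 h with h | h
  · obtain ⟨b, hb⟩ := exists_eq_signed (sub_eq_zero.1 h)
    obtain ⟨c, hc⟩ := exists_eq_signed (show w ^ 2 = β ^ 2 by linear_combination hsum - h)
    exact ⟨true, b, c, by simpa using hb, by simpa using hc⟩
  · obtain ⟨b, hb⟩ := exists_eq_signed (sub_eq_zero.1 h)
    obtain ⟨c, hc⟩ := exists_eq_signed (show w ^ 2 = α ^ 2 by linear_combination hsum - h)
    exact ⟨false, b, c, by simpa using hb, by simpa using hc⟩

/-- The range of `signedTriple α β` is cut out by the elementary symmetric functions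
of the squared coordinates. -/
theorem mem_range_signedTriple_iff {α β : ℂ} {x : Fin 3 → ℂ} :
    x ∈ Set.range (signedTriple α β) ↔
      x 0 ^ 2 + x 1 ^ 2 + x 2 ^ 2 = α ^ 2 + β ^ 2 ∧
      x 0 ^ 2 * x 1 ^ 2 + x 1 ^ 2 * x 2 ^ 2 + x 0 ^ 2 * x 2 ^ 2 = α ^ 2 * β ^ 2 ∧
      x 0 * x 1 * x 2 = 0 := by
  constructor
  · rintro ⟨⟨k, s, b, c⟩, rfl⟩
    fin_cases k <;> cases s <;> simp [signedTriple, signed_sq, add_comm, mul_comm]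
  · rintro ⟨h1, h2, h3⟩
    have hk : ∃ k : Fin 3, x k = 0 := by
      rcases mul_eq_zero.1 h3 with h | h
      · rcases mul_eq_zero.1 h with h | h
        exacts [⟨0, h⟩, ⟨1, h⟩]
      · exact ⟨2, h⟩
    obtain ⟨k, hk⟩ := hk
    have hpair : x (k + 1) ^ 2 + x (k + 2) ^ 2 = α ^ 2 + β ^ 2 ∧
        x (k + 1) ^ 2 * x (k + 2) ^ 2 = α ^ 2 * β ^ 2 := by
      rw [← h1, ← h2]
      fin_cases k <;> (simp at hk; simp [hk]; try ring_nf; simp)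
    obtain ⟨s, b, c, hb, hc⟩ := exists_signed_pair hpair.1 hpair.2
    refine ⟨(k, s, b, c), funext fun i => ?_⟩
    obtain rfl | rfl | rfl : i = k ∨ i = k + 1 ∨ i = k + 2 := by
      fin_cases k <;> fin_cases i <;> simp
    · rw [signedTriple_self, hk]
    · rw [signedTriple_add_one, hb]
    · rw [signedTriple_add_two, hc]

/-- The tangent direction with given zero place, order of `α` and `β`, and signs. -/
def directionOf (α β τ : ℂ) (d : (Fin 3 × Bool × Bool × Bool) × (Fin m → Bool)) :
    Fin (m + 4) → ℂ :=
  Matrix.vecCons (signedTriple α β d.1 0) (Matrix.vecCons (signedTriple α β d.1 1)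
    (Matrix.vecCons (signedTriple α β d.1 2) (Matrix.vecCons τ fun i => signed (d.2 i) τ)))

theorem directionOf_injective {α β τ : ℂ} (hα : α ≠ 0) (hβ : β ≠ 0) (hαβ : α ^ 2 ≠ β ^ 2)
    (hτ : τ ≠ 0) : Function.Injective (directionOf (m := m) α β τ) := by
  rintro ⟨d, e⟩ ⟨d', e'⟩ h
  simp only [directionOf, Matrix.vecCons_inj, true_and] at h
  obtain ⟨h0, h1, h2, h3⟩ := h
  have hd : d = d' := by
    refine signedTriple_injective hα hβ hαβ (funext fun i => ?_)
    fin_cases i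
    exacts [h0, h1, h2]
  have he : e = e' := funext fun i => signed_left_injective hτ (congrFun h3 i)
  rw [hd, he]

theorem range_directionOf {α β γ ρ t τ : ℂ} (hsum : α ^ 2 + β ^ 2 = 3 - γ)
    (hprod : α ^ 2 * β ^ 2 = ρ ^ 2 - γ) (hτ : τ ^ 2 = t) :
    Set.range (directionOf (m := m) α β τ) =
      {v | v 3 = τ ∧ IsTangentDirection γ ρ t v} := by
  ext v
  constructor
  · rintro ⟨⟨d, e⟩, rfl⟩
    obtain ⟨h1, h2, h3⟩ := mem_range_signedTriple_iff.1 (Set.mem_range_self (f := signedTriple α β) d)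
    refine ⟨rfl, h1.trans hsum, h2.trans hprod, h3, fun i => ?_⟩
    refine Fin.cases hτ (fun i => ?_) i
    exact (signed_sq (e i) τ).trans hτ
  · rintro ⟨hv3, h1, h2, h3, h4⟩
    obtain ⟨d, hd⟩ := (mem_range_signedTriple_iff (x := ![v 0, v 1, v 2])).2
      ⟨h1.trans hsum.symm, h2.trans hprod.symm, h3⟩
    have hsign (i : Fin m) : ∃ b, v i.succ.succ.succ.succ = signed b τ :=
      exists_eq_signed ((h4 i.succ).trans hτ.symm)
    choose e he using hsign
    refine ⟨(d, e), eq_of_coordinates_eq (congrFun hd 0) (congrFun hd 1) (congrFun hd 2) fun i => ?_⟩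
    refine Fin.cases hv3.symm (fun i => ?_) i
    exact (he i).symm

end Counting

/-- for `n ≥ 4`, if the discriminant expression does not vanish, the
tetrahedron-plus-crosspolytope configuration of `2n−2` spheres of radius `r` has exactly
`3·2^{n−1}` complex common tangent lines. -/
theorem config_tangents_count (n : ℕ) (hn : 4 ≤ n) (a r : ℝ) (ha : 0 < a) (hr : 0 < r)
    (γ : ℝ) (hγ : γ = a ^ 2 * ((n : ℝ) - 1) / (a ^ 2 + (n : ℝ) - 3))
    (hdisc : (r ^ 2 - 3) * (3 - γ) * (a ^ 2 - 2) * (r ^ 2 - γ) *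
      ((3 - γ) ^ 2 + 4 * γ - 4 * r ^ 2) ≠ 0) :
    (({L | Module.finrank ℂ L.direction = 1 ∧
        ∀ c ∈ configCenters n a, IsTangentLine L (fun j => (c j : ℂ)) r} :
          Set (AffineSubspace ℂ (Fin n → ℂ))).Finite) ∧
    (({L | Module.finrank ℂ L.direction = 1 ∧
        ∀ c ∈ configCenters n a, IsTangentLine L (fun j => (c j : ℂ)) r} :
          Set (AffineSubspace ℂ (Fin n → ℂ))).ncard = 3 * 2 ^ (n - 1)) := by
  obtain ⟨m, rfl⟩ : ∃ m, n = m + 4 := ⟨n - 4, by omega⟩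
  simp only [ne_eq, mul_eq_zero, not_or] at hdisc
  obtain ⟨⟨⟨⟨-, -⟩, ha2⟩, hrγ⟩, hdisc⟩ := hdisc
  have hN : a ^ 2 + (m + 1) ≠ 0 := by positivity
  have hγ' : γ * (a ^ 2 + (m + 1)) = a ^ 2 * (m + 3) := by
    have hden : a ^ 2 + ((m + 4 : ℕ) : ℝ) - 3 = a ^ 2 + (m + 1) := by push_cast; ring
    rw [hγ, hden, div_mul_cancel₀ _ hN]
    push_cast
    ring
  set t : ℝ := (a ^ 2 - 2) / (a ^ 2 + (m + 1)) with ht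
  have ht0 : t ≠ 0 := div_ne_zero ha2 hN
  have ht' : t * (a ^ 2 + (m + 1)) = a ^ 2 - 2 := div_mul_cancel₀ _ hN
  have hat : a ^ 2 * t = a ^ 2 - γ := by
    refine mul_right_cancel₀ hN ?_
    linear_combination a ^ 2 * ht' + hγ'
  have hNt : ((m : ℝ) + 1) * t = γ - 2 := by
    refine mul_right_cancel₀ hN ?_
    linear_combination (m + 1) * ht' - hγ'
  obtain ⟨τ, hτ⟩ := IsSquare.exists_sq _ (IsAlgClosed.exists_eq_mul_self (t : ℂ))
  obtain ⟨δ, hδ⟩ := IsSquare.exists_sq _ (IsAlgClosed.exists_eq_mul_self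
    (((3 - γ) ^ 2 + 4 * γ - 4 * r ^ 2 : ℝ) : ℂ))
  obtain ⟨α, hα⟩ := IsSquare.exists_sq _ (IsAlgClosed.exists_eq_mul_self ((3 - γ + δ) / 2 : ℂ))
  obtain ⟨β, hβ⟩ := IsSquare.exists_sq _ (IsAlgClosed.exists_eq_mul_self ((3 - γ - δ) / 2 : ℂ))
  have hsum : α ^ 2 + β ^ 2 = 3 - (γ : ℂ) := by rw [← hα, ← hβ]; ring
  have hprod : α ^ 2 * β ^ 2 = (r : ℂ) ^ 2 - γ := by
    rw [← hα, ← hβ]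
    push_cast at hδ
    linear_combination hδ / 4
  have hαβ0 : α ^ 2 * β ^ 2 ≠ 0 := by rw [hprod]; exact_mod_cast hrγ
  have hα0 : α ≠ 0 := by rintro rfl; simp at hαβ0
  have hβ0 : β ≠ 0 := by rintro rfl; simp at hαβ0
  have hαβ : α ^ 2 ≠ β ^ 2 := by
    intro h
    have hδ0 : δ = 0 := by linear_combination h + hα - hβ
    rw [hδ0, zero_pow two_ne_zero] at hδ
    exact hdisc (by exact_mod_cast hδ)
  have hτ0 : τ ≠ 0 := by
    rintro rfl
    exact ht0 (by simpa using hτ)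
  have himage := tangentLines_eq_image (m := m) (r := r) (γ := γ) (t := t) ha.ne' (by exact_mod_cast hat)
    (by exact_mod_cast hNt) hτ.symm
  rw [himage, ← range_directionOf hsum hprod hτ.symm]
  have hinj : Set.InjOn tangentLineOf (Set.range (directionOf (m := m) α β τ)) := by
    refine (tangentLineOf_injOn hτ0).mono ?_
    rintro _ ⟨d, rfl⟩
    rfl
  refine ⟨(Set.finite_range _).image _, ?_⟩
  rw [hinj.ncard_image, ← Set.image_univ,
    Set.ncard_image_of_injective _ (directionOf_injective hα0 hβ0 hαβ hτ0), Set.ncard_univ,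
    Nat.card_eq_fintype_card]
  simp
  ring
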